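/- Let H be a bialgebra over a commutative ring R, n a natural number, π an n×n matrix with entries in H satisfying Δ(π_{ab}) = Σ_c π_{ac} ⊗ π_{cb} and ε(π_{ab}) = δ_{ab}, and assume π is invertible as a matrix over H with inverse π⁻¹. Let t^1, …, t^n : H → R be R-linear functionals, and define d : H → H^n by (d a)_k = t^k_L(a) = Σ a_(1) t^k(a_(2)). Define the matrix γ over R by γ_{ij} = Σ_{a,b} t^i(π_{ab}) t^j(π_{ba}) and assume γ is invertible. Then for each i, the i-th standard basis vector e_i of H^n satisfies e_i = Σ_{j,a,b,c} (γ⁻¹)_{ij} t^j(π_{ab}) • ( (π⁻¹)_{bc} • d(π_{ca}) ), where an element h ∈ H acts on H^n by componentwise left multiplication. In particular, H^n is generated as a left H-module by the image of d (completeness of the first-order differential calculus, Proposition 5(i)). -/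

import Mathlib

open TensorProduct

/-- The left-invariant vector field `t_L(a) = Σ a_(1) t(a_(2))`. -/
noncomputable def tL (R C : Type*) [CommRing R] [AddCommGroup C] [Module R C]
    [Coalgebra R C] (t : C →ₗ[R] R) : C →ₗ[R] C :=
  (TensorProduct.rid R C).toLinearMap ∘ₗ (LinearMap.lTensor C t) ∘ₗ Coalgebra.comul

/-- Left-invariant vector fields act on a matrix coefficient by right multiplication. -/
theorem tL_matrixCoeff {R C ι : Type*} [CommRing R] [AddCommGroup C] [Module R C]
    [Coalgebra R C] [Fintype ι] (π : Matrix ι ι C)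
    (hπ : ∀ a b, Coalgebra.comul (R := R) (π a b) = ∑ c, π a c ⊗ₜ[R] π c b)
    (t : C →ₗ[R] R) (a b : ι) :
    tL R C t (π a b) = ∑ c, t (π c b) • π a c := by
  simp [tL, hπ]

/-- Multiplying by the inverse matrix recovers the value of the functional. -/
theorem sum_inv_mul_tL_matrixCoeff {R H ι : Type*} [CommRing R] [Ring H] [Bialgebra R H]
    [Fintype ι] [DecidableEq ι] (π π' : Matrix ι ι H)
    (hπ : ∀ a b, Coalgebra.comul (R := R) (π a b) = ∑ c, π a c ⊗ₜ[R] π c b)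
    (hπ'π : π' * π = 1) (t : H →ₗ[R] R) (a b : ι) :
    ∑ c, π' b c * tL R H t (π c a) = t (π b a) • (1 : H) := by
  have h (d : ι) : ∑ c, π' b c * π c d = if b = d then 1 else 0 := by
    rw [← Matrix.mul_apply, hπ'π, Matrix.one_apply]
  simp_rw [tL_matrixCoeff π hπ, Finset.mul_sum, mul_smul_comm]
  rw [Finset.sum_comm]
  simp [← Finset.smul_sum, h]

/-- completeness of the first-order differential calculus.  Given a
corepresentation matrix `π` (invertible with inverse `π'`), functionals `t^1, …, t^n`,
the differential `d a = (t^1_L a, …, t^n_L a)` and the invertible matrix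
`γ_{ij} = Σ_{a,b} t^i(π_{ab}) t^j(π_{ba})`, each standard basis vector `e_i` of `H^n` is
`e_i = Σ_{j,a,b,c} (γ⁻¹)_{ij} t^j(π_{ab}) • ((π⁻¹)_{bc} • d(π_{ca}))`; in particular `H^n`
is generated as a left `H`-module by the image of `d`. -/
theorem differential_calculus_complete (R H : Type*) [CommRing R] [Ring H] [Bialgebra R H]
    {n : ℕ} (π π' : Matrix (Fin n) (Fin n) H)
    (hπ : ∀ a b, Coalgebra.comul (R := R) (π a b) = ∑ c, π a c ⊗ₜ[R] π c b)
    (hε : ∀ a b, Coalgebra.counit (R := R) (π a b) = if a = b then (1 : R) else 0)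
    (hππ' : π * π' = 1) (hπ'π : π' * π = 1)
    (t : Fin n → (H →ₗ[R] R))
    (γ γinv : Matrix (Fin n) (Fin n) R)
    (hγ : ∀ i j, γ i j = ∑ a, ∑ b, t i (π a b) * t j (π b a))
    (hγinv1 : γ * γinv = 1) (hγinv2 : γinv * γ = 1) :
    (∀ i, Pi.single i (1 : H) =
      ∑ j, ∑ a, ∑ b, ∑ c,
        (γinv i j * t j (π a b)) • (fun k => π' b c * tL R H (t k) (π c a))) ∧
    Submodule.span H (Set.range (fun a : H => fun k => tL R H (t k) a)) = ⊤ := by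
  have key (i : Fin n) : Pi.single i (1 : H) =
      ∑ j, ∑ a, ∑ b, ∑ c,
        (γinv i j * t j (π a b)) • (fun k => π' b c * tL R H (t k) (π c a)) := by
    ext k
    have hk : ∑ j, γinv i j * γ j k = if i = k then 1 else 0 := by
      rw [← Matrix.mul_apply, hγinv2, Matrix.one_apply]
    simp only [Finset.sum_apply, Pi.smul_apply, ← Finset.smul_sum,
      sum_inv_mul_tL_matrixCoeff π π' hπ hπ'π, smul_smul, ← Finset.sum_smul, mul_assoc,
      ← Finset.mul_sum, ← hγ, hk]
    simp [Pi.single_apply, eq_comm]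
  refine ⟨key, ?_⟩
  rw [eq_top_iff, ← (Pi.basisFun H (Fin n)).span_eq, Submodule.span_le]
  rintro _ ⟨i, rfl⟩
  rw [Pi.basisFun_apply, key i]
  refine sum_mem fun j _ => sum_mem fun a _ => sum_mem fun b _ => sum_mem fun c _ =>
    Submodule.smul_of_tower_mem _ _ ?_
  exact Submodule.smul_mem _ (π' b c) (Submodule.subset_span ⟨π c a, rfl⟩)
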